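/- Let {p_n} be the strictly increasing enumeration of the odd primes, and let M be the Puiseux monoid generated by S = {1/(2^n p_n) : n ∈ ℕ}. Then 𝒜(M) = S, so M is atomic; moreover, the submonoid N = ⟨1/2^n : n ∈ ℕ⟩ of M is antimatter and hence not atomic. In particular, a submonoid of an atomic Puiseux monoid need not be atomic. -/

import Mathlib

/-- `a` is an atom of the Puiseux monoid `M`. -/
def PMAtom (M : AddSubmonoid ℚ) (a : ℚ) : Prop :=
  a ∈ M ∧ a ≠ 0 ∧ ∀ x ∈ M, ∀ y ∈ M, a = x + y → x = 0 ∨ y = 0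

/-- The set of atoms of `M`. -/
def PMAtoms (M : AddSubmonoid ℚ) : Set ℚ := {a | PMAtom M a}

/-- `M` is atomic: every element of `M` is a finite sum of atoms of `M`. -/
def PMAtomic (M : AddSubmonoid ℚ) : Prop :=
  ∀ m ∈ M, ∃ l : Multiset ℚ, (∀ a ∈ l, PMAtom M a) ∧ l.sum = m

/-- An atom of a monoid generated by a set of nonzero elements is one of the generators. -/
theorem PMAtom.mem_of_closure {S : Set ℚ} (hS : ∀ s ∈ S, s ≠ 0) {a : ℚ}
    (ha : PMAtom (AddSubmonoid.closure S) a) : a ∈ S := by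
  obtain ⟨hmem, hne, hsplit⟩ := ha
  have key : a = 0 ∨ ∃ s ∈ S, ∃ y ∈ AddSubmonoid.closure S, a = s + y := by
    clear hne hsplit
    induction hmem using AddSubmonoid.closure_induction with
    | mem x hx => exact Or.inr ⟨x, hx, 0, zero_mem _, (add_zero x).symm⟩
    | zero => exact Or.inl rfl
    | add x y _ hy ihx ihy =>
      rcases ihx with rfl | ⟨s, hs, z, hz, rfl⟩
      · simpa using ihy
      · exact Or.inr ⟨s, hs, z + y, add_mem hz hy, add_assoc s z y⟩
  rcases key with h | ⟨s, hs, y, hy, rfl⟩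
  · exact absurd h hne
  · rcases hsplit s (AddSubmonoid.subset_closure hs) y hy rfl with h | rfl
    · exact absurd h (hS s hs)
    · simpa using hs

/-- A monoid generated by atoms is atomic. -/
theorem PMAtomic.closure {S : Set ℚ} (hS : ∀ s ∈ S, PMAtom (AddSubmonoid.closure S) s) :
    PMAtomic (AddSubmonoid.closure S) := by
  intro m hm
  obtain ⟨l, hl, hsum⟩ := AddSubmonoid.exists_multiset_of_mem_closure hm
  exact ⟨l, fun a ha => hS a (hl a ha), hsum⟩

/-- If every generator is nonnegative and all generators except `s` are `q`-integral, whereas `s`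
is not, then `s` is an atom. -/
theorem PMAtom.of_padicNorm {S : Set ℚ} {s : ℚ} {q : ℕ} [Fact q.Prime] (hs : s ∈ S)
    (hnonneg : ∀ x ∈ S, 0 ≤ x) (hnorm : ∀ x ∈ S, x = s ∨ padicNorm q x ≤ 1)
    (hlt : 1 < padicNorm q s) : PMAtom (AddSubmonoid.closure S) s := by
  have key : ∀ x ∈ AddSubmonoid.closure S, 0 ≤ x ∧ (s ≤ x ∨ padicNorm q x ≤ 1) := by
    intro x hx
    induction hx using AddSubmonoid.closure_induction with
    | mem x hx => exact ⟨hnonneg x hx, (hnorm x hx).imp_left fun h => h.ge⟩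
    | zero => simp
    | add x y _ _ ihx ihy =>
      refine ⟨add_nonneg ihx.1 ihy.1, ?_⟩
      rcases ihx.2 with h | hx
      · exact Or.inl (by linarith [ihy.1])
      rcases ihy.2 with h | hy
      · exact Or.inl (by linarith [ihx.1])
      · exact Or.inr (padicNorm.nonarchimedean.trans (max_le hx hy))
  refine ⟨AddSubmonoid.subset_closure hs, ?_, ?_⟩
  · rintro rfl
    norm_num at hlt
  · intro x hx y hy hxy
    obtain ⟨hx0, hx⟩ := key x hx
    obtain ⟨hy0, hy⟩ := key y hy
    rcases hx with h | hx
    · exact Or.inr (by linarith)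
    rcases hy with h | hy
    · exact Or.inl (by linarith)
    · have := (padicNorm.nonarchimedean (p := q) (q := x) (r := y)).trans (max_le hx hy)
      rw [← hxy] at this
      exact absurd hlt this.not_gt

/-- The `q`-adic norm of `1 / (2 ^ k * r)` is that of `1 / r` when `q` is an odd prime. -/
theorem padicNorm_one_div_two_pow_mul {q : ℕ} [Fact q.Prime] (hq : Odd q) (k : ℕ) (r : ℚ) :
    padicNorm q (1 / (2 ^ k * r)) = (padicNorm q r)⁻¹ := by
  have h2 : padicNorm q 2 = 1 := by
    have : Fact (Nat.Prime 2) := ⟨Nat.prime_two⟩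
    refine padicNorm.padicNorm_of_prime_of_ne (q := 2) ?_
    rintro rfl
    exact absurd hq (by decide)
  have hpow : padicNorm q (2 ^ k) = 1 := by
    induction k with
    | zero => simp
    | succ k ih => rw [pow_succ, padicNorm.mul, ih, h2, one_mul]
  rw [padicNorm.div, padicNorm.mul, hpow, padicNorm.one, one_mul, one_div]

/-- Let `{p_n}` be the strictly increasing enumeration of the odd primes
(indexed here from `0`, the `n`-th generator being `1/(2^{n+1} p_n)`), and let
`M = ⟨1/(2^n p_n) : n⟩`. Then `𝒜(M) = {1/(2^n p_n) : n}`, so `M` is atomic; moreover the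
submonoid `N = ⟨1/2^n : n⟩` of `M` is antimatter and hence not atomic. In particular, a
submonoid of an atomic Puiseux monoid need not be atomic. -/
theorem submonoid_of_atomic_not_atomic (p : ℕ → ℕ) (hmono : StrictMono p)
    (hp : ∀ n, (p n).Prime ∧ Odd (p n))
    (hsurj : ∀ q : ℕ, q.Prime → Odd q → ∃ n, p n = q)
    (M N : AddSubmonoid ℚ)
    (hM : M = AddSubmonoid.closure
      {x : ℚ | ∃ n : ℕ, x = 1 / (2 ^ (n + 1) * (p n : ℚ))})
    (hN : N = AddSubmonoid.closure {x : ℚ | ∃ n : ℕ, x = 1 / (2 ^ (n + 1) : ℚ)}) :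
    PMAtoms M = {x : ℚ | ∃ n : ℕ, x = 1 / (2 ^ (n + 1) * (p n : ℚ))} ∧
    PMAtomic M ∧ N ≤ M ∧ PMAtoms N = ∅ ∧ ¬ PMAtomic N := by
  subst hM hN
  have hpos : ∀ n, (0 : ℚ) < p n := fun n => by exact_mod_cast (hp n).1.pos
  have hatom : ∀ s ∈ {x : ℚ | ∃ n : ℕ, x = 1 / (2 ^ (n + 1) * (p n : ℚ))},
      PMAtom (AddSubmonoid.closure {x : ℚ | ∃ n : ℕ, x = 1 / (2 ^ (n + 1) * (p n : ℚ))}) s := by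
    rintro _ ⟨n, rfl⟩
    have : Fact (p n).Prime := ⟨(hp n).1⟩
    refine PMAtom.of_padicNorm (q := p n) ⟨n, rfl⟩ ?_ ?_ ?_
    · rintro _ ⟨i, rfl⟩
      have := hpos i
      positivity
    · rintro _ ⟨i, rfl⟩
      rcases eq_or_ne i n with rfl | hin
      · exact Or.inl rfl
      · have : Fact (p i).Prime := ⟨(hp i).1⟩
        right
        rw [padicNorm_one_div_two_pow_mul (hp n).2,
          padicNorm.padicNorm_of_prime_of_ne fun h => hin (hmono.injective h.symm), inv_one]
    · rw [padicNorm_one_div_two_pow_mul (hp n).2, padicNorm.padicNorm_p (hp n).1.one_lt, inv_inv]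
      exact_mod_cast (hp n).1.one_lt
  have hanti : PMAtoms (AddSubmonoid.closure {x : ℚ | ∃ n : ℕ, x = 1 / (2 ^ (n + 1) : ℚ)}) = ∅ := by
    refine Set.eq_empty_of_forall_notMem fun a ha => ?_
    obtain ⟨n, rfl⟩ := PMAtom.mem_of_closure (by rintro _ ⟨n, rfl⟩; positivity) ha
    have hhalf : (1 / 2 ^ (n + 1 + 1) : ℚ) ∈
        AddSubmonoid.closure {x : ℚ | ∃ n : ℕ, x = 1 / (2 ^ (n + 1) : ℚ)} :=
      AddSubmonoid.subset_closure ⟨n + 1, rfl⟩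
    have hne : (1 / 2 ^ (n + 1 + 1) : ℚ) ≠ 0 := by positivity
    exact (ha.2.2 _ hhalf _ hhalf (by field_simp; ring)).elim hne hne
  refine ⟨?_, PMAtomic.closure hatom, ?_, hanti, ?_⟩
  · refine Set.Subset.antisymm (fun a ha => PMAtom.mem_of_closure ?_ ha) hatom
    exact fun s hs => (hatom s hs).2.1
  · rw [AddSubmonoid.closure_le]
    rintro _ ⟨n, rfl⟩
    have hgen : (1 / 2 ^ (n + 1) : ℚ) = p n • (1 / (2 ^ (n + 1) * (p n : ℚ))) := by
      have := (hpos n).ne'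
      rw [nsmul_eq_mul]
      field_simp
    rw [hgen]
    refine nsmul_mem (AddSubmonoid.subset_closure ?_) _
    exact ⟨n, rfl⟩
  · intro h
    obtain ⟨l, hl, hsum⟩ := h (1 / 2 ^ (0 + 1)) (AddSubmonoid.subset_closure ⟨0, rfl⟩)
    have hl0 : l = 0 := Multiset.eq_zero_of_forall_notMem fun a ha =>
      (Set.eq_empty_iff_forall_notMem.mp hanti) a (hl a ha)
    norm_num [hl0] at hsum
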